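/- arXiv:0901.0618 — 3 statements merged into one kernel-verified Lean document; each statement's English description precedes it below -/
import Mathlib

section
/- A V-category (X,a) admits an Eilenberg–Moore algebra structure for the Hausdorff monad — that is, a V-functor α : HX → X with α({x}) = x for all x ∈ X and k ≤ h_X(A, {α(A)}) for all A ⊆ X — if and only if every subset A ⊆ X has a supremum ⋁A in the order induced on X and a(⋁A, y) = ⋀_{x∈A} a(x,y) holds for all A ⊆ X and y ∈ X. Moreover, for any such α, α(A) is a supremum of A in the induced order. -/
universe u v

/-- A commutative unital quantale: a complete lattice with a commutative monoid
structure whose multiplication preserves arbitrary suprema in each variable,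
and whose unit `k = 1` satisfies `⊥ < 1`. -/
class CommQuantale (V : Type u) extends CompleteLattice V, CommMonoid V where
  mul_sSup : ∀ (a : V) (s : Set V), a * sSup s = ⨆ b ∈ s, a * b
  bot_lt_one : (⊥ : V) < 1

variable {V : Type u} [CommQuantale V]

/-- The internal hom `x ⊸ y` of the quantale, characterized by `z ≤ x ⊸ y ↔ z * x ≤ y`. -/
def qhom (x y : V) : V := sSup {z : V | z * x ≤ y}

/-- `a : X → X → V` is a `V`-category structure. -/
def IsVCat {X : Type*} (a : X → X → V) : Prop :=
  (∀ x, (1 : V) ≤ a x x) ∧ (∀ x y z, a x y * a y z ≤ a x z)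

/-- `f` is a `V`-functor from `(X,a)` to `(Y,b)`. -/
def IsVFun {X Y : Type*} (a : X → X → V) (b : Y → Y → V) (f : X → Y) : Prop :=
  ∀ x y, a x y ≤ b (f x) (f y)

/-- `φ` is a `V`-module from `(X,a)` to `(Y,b)`. -/
def IsVMod {X Y : Type*} (a : X → X → V) (b : Y → Y → V) (φ : X → Y → V) : Prop :=
  (∀ x' x y, a x' x * φ x y ≤ φ x' y) ∧ (∀ x y y', φ x y * b y y' ≤ φ x y')

/-- The Hausdorff formula: for `φ = a` this is the Hausdorff structure `h_X` on `P X`;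
for a `V`-module `φ` it is the lax (Hausdorff) extension `H̃φ`. -/
def hf {X Y : Type*} (φ : X → Y → V) (A : Set X) (B : Set Y) : V :=
  ⨅ x ∈ A, ⨆ y ∈ B, φ x y

/-- Module composition: `mcomp φ ψ` is `ψ · φ` in the paper's notation. -/
def mcomp {X Y Z : Type*} (φ : X → Y → V) (ψ : Y → Z → V) : X → Z → V :=
  fun x z => ⨆ y, φ x y * ψ y z

/-- The Gromov–Hausdorff "distance": the join of `H̃φ(X,Y)` over all `V`-modules
`φ : X ⇸ Y`. -/
def GH {X Y : Type*} (a : X → X → V) (b : Y → Y → V) : V :=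
  ⨆ φ : {φ : X → Y → V // IsVMod a b φ}, hf φ.1 Set.univ Set.univ

/-- `s` is a supremum of `A` in the order induced by the V-category structure `a`
(`x ≤ y ↔ k ≤ a x y`): an upper bound below every upper bound. -/
def IsSupIn {X : Type*} (a : X → X → V) (A : Set X) (s : X) : Prop :=
  (∀ x ∈ A, (1 : V) ≤ a x s) ∧ ∀ y, (∀ x ∈ A, (1 : V) ≤ a x y) → (1 : V) ≤ a s y

theorem cq_mul_mono (c : V) {x y : V} (h : x ≤ y) : c * x ≤ c * y := by
  have h1 := CommQuantale.mul_sSup c {x, y}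
  rw [sSup_pair, sup_eq_right.2 h] at h1
  rw [h1]
  exact le_iSup₂_of_le x (by simp) le_rfl

theorem vcat_left {X : Type*} {a : X → X → V} (ha : IsVCat a) {x y : X} (z : X)
    (h : (1 : V) ≤ a x y) : a y z ≤ a x z := by
  have h1 := cq_mul_mono (a y z) h
  rw [mul_one, mul_comm] at h1
  exact h1.trans (ha.2 x y z)

theorem vcat_right {X : Type*} {a : X → X → V} (ha : IsVCat a) {y z : X} (x : X)
    (h : (1 : V) ≤ a y z) : a x y ≤ a x z := by
  have h1 := cq_mul_mono (a x y) h
  rw [mul_one] at h1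
  exact h1.trans (ha.2 x y z)

theorem sup_of_alg {X : Type*} {a : X → X → V} (ha : IsVCat a) (α : Set X → X)
    (hf1 : IsVFun (hf a) a α) (h1 : ∀ x, α ({x} : Set X) = x)
    (h2 : ∀ A : Set X, (1 : V) ≤ hf a A ({α A} : Set X)) (A : Set X) :
    IsSupIn a A (α A) ∧ ∀ y : X, a (α A) y = ⨅ x ∈ A, a x y := by
  have ub : ∀ x ∈ A, (1 : V) ≤ a x (α A) := by
    have := h2 A
    simpa [hf] using this
  have eq : ∀ y : X, a (α A) y = ⨅ x ∈ A, a x y := by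
    intro y
    apply le_antisymm
    · exact le_iInf₂ fun x hx => vcat_left ha y (ub x hx)
    · have := hf1 A {y}
      rw [h1 y] at this
      simpa [hf] using this
  refine ⟨⟨ub, fun y hy => ?_⟩, eq⟩
  rw [eq]
  exact le_iInf₂ hy

/-- `(X,a)` admits an Eilenberg–Moore algebra structure for the Hausdorff
monad — a V-functor `α : HX → X` with `α {x} = x` and `k ≤ h_X(A, {α A})` — iff every
subset `A` has a supremum `⋁A` in the induced order with `a(⋁A, y) = ⋀_{x∈A} a(x,y)`
for all `y`.  Moreover, for any such `α`, `α A` is a supremum of `A`. -/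
theorem hausdorff_algebras {X : Type v} (a : X → X → V) (ha : IsVCat a) :
    ((∃ α : Set X → X, IsVFun (hf a) a α ∧ (∀ x, α ({x} : Set X) = x) ∧
        ∀ A : Set X, (1 : V) ≤ hf a A ({α A} : Set X))
      ↔ ∀ A : Set X, ∃ s : X, IsSupIn a A s ∧ ∀ y : X, a s y = ⨅ x ∈ A, a x y) ∧
    (∀ α : Set X → X, IsVFun (hf a) a α → (∀ x, α ({x} : Set X) = x) →
      (∀ A : Set X, (1 : V) ≤ hf a A ({α A} : Set X)) →
      ∀ A : Set X, IsSupIn a A (α A)) := by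
  refine ⟨⟨?_, ?_⟩, fun α h0 h1 h2 A => (sup_of_alg ha α h0 h1 h2 A).1⟩
  · rintro ⟨α, h0, h1, h2⟩ A
    exact ⟨α A, sup_of_alg ha α h0 h1 h2 A⟩
  · intro H
    have H' : ∀ A : Set X, ∃ s : X, (IsSupIn a A s ∧ ∀ y : X, a s y = ⨅ x ∈ A, a x y) ∧
        ∀ x, A = {x} → s = x := by
      intro A
      by_cases hA : ∃ x, A = {x}
      · obtain ⟨x, rfl⟩ := hA
        refine ⟨x, ⟨⟨?_, ?_⟩, ?_⟩, fun y hy => Set.singleton_injective hy⟩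
        · rintro y rfl
          exact ha.1 y
        · intro y hy
          exact hy x rfl
        · intro y
          simp
      · obtain ⟨s, hs⟩ := H A
        exact ⟨s, hs, fun x hx => (hA ⟨x, hx⟩).elim⟩
    choose α hα h1 using H'
    refine ⟨α, fun A B => ?_, fun x => h1 _ x rfl, fun A => ?_⟩
    · rw [(hα A).2]
      exact iInf₂_mono fun x _ => iSup₂_le fun y hy => vcat_right ha x ((hα B).1.1 y hy)
    · have := (hα A).1.1
      simpa [hf] using this
end

section
/- The assignment φ ↦ H̃φ, where H̃φ(A,B) = ⋀_{x∈A} ⋁_{y∈B} φ(x,y), is a lax functor VMod → VMod extending the Hausdorff functor H: (i) for every V-module φ : (X,a) ⇸ (Y,b), H̃φ is a V-module HX ⇸ HY; (ii) H̃(1_X^*) = h_X = 1_{HX}^*; (iii) for V-modules φ : X ⇸ Y and ψ : Y ⇸ Z, H̃ψ · H̃φ ≤ H̃(ψ · φ); (iv) for every V-functor f : X → Y, H̃(f_*) = (Hf)_* and H̃(f^*) = (Hf)^*, where Hf is the direct-image V-functor. -/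
universe u v

variable {V : Type u} [CommQuantale V]

theorem q_mul_sup {ι : Type*} (x : V) (s : Set ι) (g : ι → V) (t : V)
    (h : ∀ i ∈ s, x * g i ≤ t) : x * (⨆ i ∈ s, g i) ≤ t := by
  rw [← sSup_image, CommQuantale.mul_sSup]
  refine iSup₂_le ?_
  rintro _ ⟨i, hi, rfl⟩
  exact h i hi

theorem q_mul_mono (x : V) {y z : V} (h : y ≤ z) : x * y ≤ x * z := by
  have e : z = sSup {y, z} := by rw [sSup_pair, sup_eq_right.2 h]
  rw [e, CommQuantale.mul_sSup]
  exact le_iSup₂_of_le y (by simp) le_rfl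

theorem hf_comp_le {X Y Z : Type*} (φ : X → Y → V) (ψ : Y → Z → V) (χ : X → Z → V)
    (h : ∀ x y z, φ x y * ψ y z ≤ χ x z) (A : Set X) (B : Set Y) (C : Set Z) :
    hf φ A B * hf ψ B C ≤ hf χ A C := by
  refine le_iInf₂ fun x hx => ?_
  have h1 : hf φ A B ≤ ⨆ y ∈ B, φ x y := iInf₂_le x hx
  rw [mul_comm]
  refine (q_mul_mono _ h1).trans (q_mul_sup _ _ _ _ fun y hy => ?_)
  have h2 : hf ψ B C ≤ ⨆ z ∈ C, ψ y z := iInf₂_le y hy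
  rw [mul_comm]
  refine (q_mul_mono _ h2).trans (q_mul_sup _ _ _ _ fun z hz => ?_)
  exact (h x y z).trans (le_iSup₂ (f := fun z (_ : z ∈ C) => χ x z) z hz)

/-- `φ ↦ H̃φ` (with `H̃φ(A,B) = ⋀_{x∈A}⋁_{y∈B} φ(x,y)`, here `hf φ`)
is a lax functor VMod → VMod extending the Hausdorff functor `H`:
(i) `H̃φ` is a V-module `HX ⇸ HY`; (ii) `H̃(1_X^*) = h_X = 1_{HX}^*` (in this
encoding both sides are `hf a`); (iii) `H̃ψ · H̃φ ≤ H̃(ψ·φ)`; (iv) for every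
V-functor `f`, `H̃(f_*) = (Hf)_*` and `H̃(f^*) = (Hf)^*`. -/
theorem hausdorff_lax_functor {X Y Z : Type v} (a : X → X → V) (b : Y → Y → V)
    (c : Z → Z → V) (ha : IsVCat a) (hb : IsVCat b) (hc : IsVCat c) :
    (∀ φ : X → Y → V, IsVMod a b φ → IsVMod (hf a) (hf b) (hf φ)) ∧
    (∀ A B : Set X, hf a A B = hf a A B) ∧
    (∀ (φ : X → Y → V) (ψ : Y → Z → V), IsVMod a b φ → IsVMod b c ψ →
      ∀ (A : Set X) (C : Set Z), mcomp (hf φ) (hf ψ) A C ≤ hf (mcomp φ ψ) A C) ∧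
    (∀ f : X → Y, IsVFun a b f →
      (∀ (A : Set X) (B : Set Y), hf (fun x y => b (f x) y) A B = hf b (f '' A) B) ∧
      (∀ (B : Set Y) (A : Set X), hf (fun y x => b y (f x)) B A = hf b B (f '' A))) := by
  refine ⟨fun φ h => ⟨fun A B C => hf_comp_le _ _ _ h.1 A B C,
    fun A B C => hf_comp_le _ _ _ h.2 A B C⟩, fun _ _ => rfl, ?_, ?_⟩
  · intro φ ψ _ _ A C
    refine iSup_le fun B => hf_comp_le _ _ _ (fun x y z => ?_) A B C
    exact le_iSup (fun y => φ x y * ψ y z) y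
  · intro f _
    exact ⟨fun A B => by simp only [hf, iInf_image], fun B A => by simp only [hf, iSup_image]⟩
end

section
/- The tensor product makes the Gromov–Hausdorff V-category a monoid in the monoidal category of (possibly large) V-categories: for all V-categories X, X', Y, Y', GH(X,X') ⊗ GH(Y,Y') ≤ GH(X ⊗ Y, X' ⊗ Y'), where X ⊗ Y = (X × Y, a ⊗ b) with (a ⊗ b)((x,y),(x',y')) = a(x,x') ⊗ b(y,y'). -/
universe u v

variable {V : Type u} [CommQuantale V]

theorem q_mul_sSup_le (a c : V) (s : Set V) (h : ∀ b ∈ s, a * b ≤ c) : a * sSup s ≤ c := by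
  rw [CommQuantale.mul_sSup]
  exact iSup₂_le h

theorem q_mul_iSup_le {ι : Sort*} (a c : V) (f : ι → V) (h : ∀ i, a * f i ≤ c) :
    a * iSup f ≤ c := by
  apply q_mul_sSup_le
  rintro _ ⟨i, rfl⟩
  exact h i

theorem q_iSup_mul_le {ι : Sort*} (a c : V) (f : ι → V) (h : ∀ i, f i * a ≤ c) :
    iSup f * a ≤ c := by
  rw [mul_comm]
  apply q_mul_iSup_le
  intro i
  rw [mul_comm]
  exact h i

theorem q_mul_le_left (a : V) {b c : V} (h : b ≤ c) : a * b ≤ a * c := by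
  have e : c = sSup {b, c} := by
    rw [sSup_pair]
    exact (sup_eq_right.mpr h).symm
  have h2 : a * sSup {b, c} = ⨆ d ∈ ({b, c} : Set V), a * d := CommQuantale.mul_sSup a _
  rw [← e] at h2
  rw [h2]
  exact le_iSup₂_of_le b (by simp) le_rfl

theorem q_mul_le {a b c d : V} (h : a ≤ b) (h' : c ≤ d) : a * c ≤ b * d := by
  refine (q_mul_le_left a h').trans ?_
  rw [mul_comm a, mul_comm b]
  exact q_mul_le_left d h

/-- the tensor product `X ⊗ Y = (X × Y, a ⊗ b)`, with
`(a⊗b)((x,y),(x',y')) = a(x,x') ⊗ b(y,y')`, makes the Gromov–Hausdorff V-category a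
monoid in the monoidal category of large V-categories:
`GH(X,X') ⊗ GH(Y,Y') ≤ GH(X ⊗ Y, X' ⊗ Y')`. -/
theorem GH_tensor_monoid {X X' Y Y' : Type v}
    (a : X → X → V) (a' : X' → X' → V) (b : Y → Y → V) (b' : Y' → Y' → V)
    (ha : IsVCat a) (ha' : IsVCat a') (hb : IsVCat b) (hb' : IsVCat b') :
    GH a a' * GH b b' ≤
      GH (fun p q : X × Y => a p.1 q.1 * b p.2 q.2)
         (fun p q : X' × Y' => a' p.1 q.1 * b' p.2 q.2) := by
  unfold GH
  refine q_iSup_mul_le _ _ _ fun φ => q_mul_iSup_le _ _ _ fun ψ => ?_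
  obtain ⟨φ, hφ⟩ := φ
  obtain ⟨ψ, hψ⟩ := ψ
  refine le_iSup_of_le ⟨fun p q => φ p.1 q.1 * ψ p.2 q.2, ?_, ?_⟩ ?_
  · intro x' x y
    beta_reduce
    rw [mul_mul_mul_comm]
    exact q_mul_le (hφ.1 _ _ _) (hψ.1 _ _ _)
  · intro x y y'
    beta_reduce
    rw [mul_mul_mul_comm]
    exact q_mul_le (hφ.2 _ _ _) (hψ.2 _ _ _)
  · unfold hf
    refine le_iInf₂ fun p _ => ?_
    refine (q_mul_le (iInf₂_le p.1 trivial) (iInf₂_le p.2 trivial)).trans ?_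
    refine q_iSup_mul_le _ _ _ fun x => q_iSup_mul_le _ _ _ fun _ =>
      q_mul_iSup_le _ _ _ fun y => q_mul_iSup_le _ _ _ fun _ => ?_
    exact le_iSup₂_of_le (f := fun (q : X' × Y') (_ : q ∈ Set.univ) => φ p.1 q.1 * ψ p.2 q.2)
      (x, y) trivial le_rfl
end
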